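/- (Uniform convergence of the quasi-interpolation operator.) Let q and α be real numbers with 0 < q < 1 and α > 0, and let f : ℝ → ℝ be bounded and uniformly continuous. Then sup_{x ∈ ℝ} |A_n(f; x) − f(x)| → 0 as n → ∞; that is, the operators A_n(f; ·) converge to f uniformly on ℝ. -/

import Mathlib

/-- The generalized hyperbolic tangent activation function. -/
noncomputable def h (q α x : ℝ) : ℝ :=
  (Real.exp (α * x) - q * Real.exp (-(α * x))) /
    ((1 + q) * Real.exp (α * x) + (1 - q) * Real.exp (-(α * x)))

/-- The associated density function. -/
noncomputable def ψ (q α x : ℝ) : ℝ :=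
  ((1 - q ^ 2) / (2 * (1 + q ^ 2))) * (h q α (x + 1) - h q α (x - 1))

/-- The quasi-interpolation neural network operator. -/
noncomputable def A (q α : ℝ) (n : ℕ) (f : ℝ → ℝ) (x : ℝ) : ℝ :=
  ∑' k : ℤ, f (k / n) * ψ q α (n * x - k)

/-- The Kantorovich-type neural network operator. -/
noncomputable def K (q α : ℝ) (n : ℕ) (f : ℝ → ℝ) (x : ℝ) : ℝ :=
  ∑' k : ℤ, ((n : ℝ) * ∫ t in ((k : ℝ) / n)..(((k : ℝ) + 1) / n), f t) * ψ q α (n * x - k)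

open Filter Topology

lemma h_eq_sigmoid {q : ℝ} (hq0 : 0 < q) (hq1 : q < 1) (α x : ℝ) :
    h q α x = -q / (1 - q) + (1 + q ^ 2) / (1 - q ^ 2) *
      Real.sigmoid (2 * α * x - Real.log ((1 - q) / (1 + q))) := by
  have h1 : 0 < 1 - q := by linarith
  have h2 : 0 < 1 + q := by linarith
  have hE : 0 < Real.exp (α * x) := Real.exp_pos _
  have hexp : Real.exp (-(2 * α * x - Real.log ((1 - q) / (1 + q)))) =
      (1 - q) / (1 + q) * ((Real.exp (α * x))⁻¹ * (Real.exp (α * x))⁻¹) := by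
    rw [← Real.exp_neg, ← Real.exp_add, ← Real.exp_log (div_pos h1 h2), ← Real.exp_add,
      Real.log_exp]
    ring_nf
  have hsq : 1 - q ^ 2 = (1 - q) * (1 + q) := by ring
  rw [h, Real.sigmoid_def, hexp, Real.exp_neg, hsq]
  generalize Real.exp (α * x) = E at hE
  have h3 : 0 < (1 + q) * E ^ 2 + (1 - q) := by positivity
  have h4 : (1 + q) * E + (1 - q) * E⁻¹ = ((1 + q) * E ^ 2 + (1 - q)) / E := by
    field_simp
  have h5 : 1 + (1 - q) / (1 + q) * (E⁻¹ * E⁻¹) =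
      ((1 + q) * E ^ 2 + (1 - q)) / ((1 + q) * E ^ 2) := by
    field_simp
  rw [h4, h5]
  field_simp
  ring

lemma ψ_eq_sigmoid {q : ℝ} (hq0 : 0 < q) (hq1 : q < 1) (α x : ℝ) :
    ψ q α x = (Real.sigmoid (2 * α * (x + 1) - Real.log ((1 - q) / (1 + q))) -
      Real.sigmoid (2 * α * (x - 1) - Real.log ((1 - q) / (1 + q)))) / 2 := by
  have h1 : 1 - q ^ 2 ≠ 0 := by nlinarith
  have h2 : 1 + q ^ 2 ≠ 0 := by positivity
  rw [ψ, h_eq_sigmoid hq0 hq1, h_eq_sigmoid hq0 hq1]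
  field_simp
  ring

lemma ψ_nonneg {q α : ℝ} (hq0 : 0 < q) (hq1 : q < 1) (hα : 0 < α) (x : ℝ) : 0 ≤ ψ q α x := by
  rw [ψ_eq_sigmoid hq0 hq1]
  have := Real.sigmoid_le (a := 2 * α * (x - 1) - Real.log ((1 - q) / (1 + q)))
    (b := 2 * α * (x + 1) - Real.log ((1 - q) / (1 + q))) (by nlinarith)
  linarith

lemma Real.sigmoid_le_exp (x : ℝ) : Real.sigmoid x ≤ Real.exp x := by
  rw [Real.sigmoid_def, inv_le_comm₀ (by positivity) (Real.exp_pos x), ← Real.exp_neg]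
  linarith

lemma ψ_le_exp {q : ℝ} (hq0 : 0 < q) (hq1 : q < 1) (α x : ℝ) :
    ψ q α x ≤ Real.exp (2 * α + |Real.log ((1 - q) / (1 + q))|) *
      Real.exp (-(2 * α * |x|)) := by
  rw [ψ_eq_sigmoid hq0 hq1, ← Real.exp_add]
  set L := Real.log ((1 - q) / (1 + q))
  set a := 2 * α * (x + 1) - L with ha
  set b := 2 * α * (x - 1) - L with hb
  have hL := neg_abs_le L
  have hL' := le_abs_self L
  rcases le_total 0 x with hx | hx
  · have h1 := Real.sigmoid_le_exp (-b)
    rw [Real.sigmoid_neg] at h1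
    have h2 := Real.sigmoid_le_one a
    have h3 : Real.exp (-b) ≤ Real.exp (2 * α + |L| + -(2 * α * |x|)) := by
      rw [abs_of_nonneg hx]
      exact Real.exp_le_exp.2 (by linarith)
    have := Real.exp_pos (-b)
    linarith
  · have h1 := Real.sigmoid_le_exp a
    have h2 := Real.sigmoid_nonneg b
    have h3 : Real.exp a ≤ Real.exp (2 * α + |L| + -(2 * α * |x|)) := by
      rw [abs_of_nonpos hx]
      exact Real.exp_le_exp.2 (by linarith)
    have := Real.exp_pos a
    linarith

/-- The integer translates of `ψ` form a partition of unity. -/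
lemma hasSum_ψ {q α : ℝ} (hq0 : 0 < q) (hq1 : q < 1) (hα : 0 < α) (y : ℝ) :
    HasSum (fun k : ℤ => ψ q α (y - k)) 1 := by
  set L := Real.log ((1 - q) / (1 + q)) with hL
  let T : ℝ → ℝ := fun t =>
    (Real.sigmoid (2 * α * (y - t + 1) - L) + Real.sigmoid (2 * α * (y - t) - L)) / 2
  have hψ (t : ℝ) : ψ q α (y - t) = T t - T (t + 1) := by
    simp only [T, ψ_eq_sigmoid hq0 hq1, ← hL]
    ring_nf
  have hα2 : 0 < 2 * α := by positivity
  have hlin : Tendsto (fun n : ℕ => 2 * α * (n : ℝ)) atTop atTop :=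
    tendsto_natCast_atTop_atTop.const_mul_atTop hα2
  have htop : Tendsto (fun n : ℕ => T n) atTop (𝓝 0) := by
    have key (c : ℝ) : Tendsto (fun n : ℕ => Real.sigmoid (c - 2 * α * n)) atTop (𝓝 0) :=
      Real.tendsto_sigmoid_atBot.comp (tendsto_atBot_add_const_left _ c
        (tendsto_neg_atTop_atBot.comp hlin))
    have := ((key (2 * α * (y + 1) - L)).add (key (2 * α * y - L))).div_const 2
    simp only [add_zero, zero_div] at this
    refine this.congr fun n => ?_
    simp only [T]
    ring_nf
  have hbot : Tendsto (fun n : ℕ => T (-n)) atTop (𝓝 1) := by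
    have key (c : ℝ) : Tendsto (fun n : ℕ => Real.sigmoid (c + 2 * α * n)) atTop (𝓝 1) :=
      Real.tendsto_sigmoid_atTop.comp (tendsto_atTop_add_const_left _ c hlin)
    have := ((key (2 * α * (y + 1) - L)).add (key (2 * α * y - L))).div_const 2
    norm_num at this
    refine this.congr fun n => ?_
    simp only [T]
    ring_nf
  have hpos : HasSum (fun n : ℕ => ψ q α (y - ((n : ℤ) : ℝ))) (T 0) := by
    rw [hasSum_iff_tendsto_nat_of_nonneg fun n => ψ_nonneg hq0 hq1 hα _]
    have hs (n : ℕ) : ∑ i ∈ Finset.range n, ψ q α (y - ((i : ℤ) : ℝ)) = T 0 - T n := by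
      have := Finset.sum_range_sub' (fun i : ℕ => T i) n
      push_cast at this ⊢
      simp only [hψ, this]
    simp only [hs]
    simpa using htop.const_sub (T 0)
  have hneg : HasSum (fun n : ℕ => ψ q α (y - ((-((n : ℤ) + 1) : ℤ) : ℝ))) (1 - T 0) := by
    rw [hasSum_iff_tendsto_nat_of_nonneg fun n => ψ_nonneg hq0 hq1 hα _]
    have hs (n : ℕ) : ∑ i ∈ Finset.range n, ψ q α (y - ((-((i : ℤ) + 1) : ℤ) : ℝ)) =
        T (-n) - T 0 := by
      have := Finset.sum_range_sub (fun i : ℕ => T (-i)) n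
      push_cast at this ⊢
      simp only [hψ]
      rw [neg_zero] at this
      rw [← this]
      refine Finset.sum_congr rfl fun i _ => ?_
      ring_nf
    simp only [hs]
    exact hbot.sub_const (T 0)
  have hsum := HasSum.of_nat_of_neg_add_one (f := fun k : ℤ => ψ q α (y - k)) hpos hneg
  rwa [add_sub_cancel] at hsum

/-- The discrete first absolute moments of `ψ` are finite and uniformly bounded. -/
lemma exists_moment_bound {q α : ℝ} (hq0 : 0 < q) (hq1 : q < 1) (hα : 0 < α) :
    ∃ C : ℝ, 0 ≤ C ∧ ∀ y : ℝ, Summable (fun k : ℤ => |y - k| * ψ q α (y - k)) ∧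
      ∑' k : ℤ, |y - k| * ψ q α (y - k) ≤ C := by
  set D := Real.exp (2 * α + |Real.log ((1 - q) / (1 + q))|)
  set ρ := Real.exp (-(2 * α)) with hρ
  have hρ1 : ‖ρ‖ < 1 := by
    rw [Real.norm_of_nonneg (Real.exp_pos _).le]
    exact Real.exp_lt_one_iff.2 (by linarith)
  let u : ℤ → ℝ := fun j => D * Real.exp (2 * α) * ((|(j : ℝ)| + 1) * ρ ^ j.natAbs)
  have hu0 (j : ℤ) : 0 ≤ u j := by positivity
  have hnat : Summable (fun n : ℕ => ((n : ℝ) + 1) * ρ ^ n) := by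
    have h1 := summable_pow_mul_geometric_of_norm_lt_one 1 hρ1
    have h0 := summable_pow_mul_geometric_of_norm_lt_one 0 hρ1
    refine (h1.add h0).congr fun n => ?_
    ring
  have hu : Summable u := by
    refine Summable.mul_left _ (Summable.of_nat_of_neg ?_ ?_) <;> simpa using hnat
  refine ⟨∑' j, u j, tsum_nonneg hu0, fun y => ?_⟩
  have hushift : Summable (fun k : ℤ => u (k - ⌊y⌋)) :=
    (Equiv.subRight ⌊y⌋).summable_iff.2 hu
  have hle (k : ℤ) : |y - k| * ψ q α (y - k) ≤ u (k - ⌊y⌋) := by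
    have hf0 := Int.fract_nonneg y
    have hf1 := (Int.fract_lt_one y).le
    have hfabs : |Int.fract y| ≤ 1 := by rwa [abs_of_nonneg hf0]
    have hy : y - k = Int.fract y - ((k - ⌊y⌋ : ℤ) : ℝ) := by
      push_cast
      rw [Int.fract]
      ring
    generalize k - ⌊y⌋ = j at hy
    have h1 : |y - k| ≤ |(j : ℝ)| + 1 := by
      rw [hy]
      linarith [abs_sub (Int.fract y) (j : ℝ)]
    have h2 : |(j : ℝ)| - 1 ≤ |y - k| := by
      rw [hy, abs_sub_comm]
      linarith [abs_sub_abs_le_abs_sub (j : ℝ) (Int.fract y)]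
    have hpow : ρ ^ j.natAbs = Real.exp (-(2 * α) * |(j : ℝ)|) := by
      rw [hρ, ← Real.exp_nat_mul, Nat.cast_natAbs, Int.cast_abs, mul_comm]
    have h3 : ψ q α (y - k) ≤ D * (Real.exp (2 * α) * ρ ^ j.natAbs) := by
      refine (ψ_le_exp hq0 hq1 α _).trans ?_
      rw [hpow, ← Real.exp_add (2 * α) (-(2 * α) * |(j : ℝ)|)]
      refine mul_le_mul_of_nonneg_left (Real.exp_le_exp.2 ?_) (Real.exp_pos _).le
      nlinarith
    calc |y - k| * ψ q α (y - k)
        ≤ (|(j : ℝ)| + 1) * (D * (Real.exp (2 * α) * ρ ^ j.natAbs)) :=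
          mul_le_mul h1 h3 (ψ_nonneg hq0 hq1 hα _) (by positivity)
      _ = u j := by simp only [u]; ring
  have hsum : Summable (fun k : ℤ => |y - k| * ψ q α (y - k)) :=
    Summable.of_nonneg_of_le (fun k => mul_nonneg (abs_nonneg _) (ψ_nonneg hq0 hq1 hα _))
      hle hushift
  exact ⟨hsum, (hsum.tsum_le_tsum hle hushift).trans_eq ((Equiv.subRight ⌊y⌋).tsum_eq u)⟩

lemma abs_A_sub_le {q α : ℝ} (hq0 : 0 < q) (hq1 : q < 1) (hα : 0 < α) {f : ℝ → ℝ} {C ε B : ℝ}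
    (hB : 0 ≤ B) (hf : ∀ a b, |f a - f b| ≤ ε + B * |a - b|)
    (hC : ∀ y : ℝ, Summable (fun k : ℤ => |y - k| * ψ q α (y - k)) ∧
      ∑' k : ℤ, |y - k| * ψ q α (y - k) ≤ C)
    {n : ℕ} (hn : 0 < n) (x : ℝ) :
    |A q α n f x - f x| ≤ ε + B / n * C := by
  have hn' : (0 : ℝ) < n := by exact_mod_cast hn
  obtain ⟨hmom, hmomC⟩ := hC (n * x)
  have hone := hasSum_ψ hq0 hq1 hα (n * x)
  have hbound := (hone.mul_left ε).add (hmom.hasSum.mul_left (B / n))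
  have hle (k : ℤ) : ‖(f (k / n) - f x) * ψ q α (n * x - k)‖ ≤
      ε * ψ q α (n * x - k) + B / n * (|n * x - k| * ψ q α (n * x - k)) := by
    have h0 := ψ_nonneg hq0 hq1 hα (n * x - k)
    have h1 : |(k : ℝ) / n - x| = |n * x - k| / n := by
      rw [abs_sub_comm, ← abs_of_pos hn', ← abs_div, abs_of_pos hn']
      congr 1
      field_simp
    rw [norm_mul, Real.norm_eq_abs, Real.norm_of_nonneg h0]
    calc |f (k / n) - f x| * ψ q α (n * x - k)
        ≤ (ε + B * |(k : ℝ) / n - x|) * ψ q α (n * x - k) :=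
          mul_le_mul_of_nonneg_right (hf _ _) h0
      _ = _ := by rw [h1]; ring
  have hdiff : Summable (fun k : ℤ => (f (k / n) - f x) * ψ q α (n * x - k)) :=
    Summable.of_norm_bounded hbound.summable hle
  have hA : A q α n f x = ∑' k : ℤ, (f (k / n) - f x) * ψ q α (n * x - k) + f x := by
    have := (hdiff.hasSum.add (hone.mul_left (f x))).tsum_eq
    rw [mul_one] at this
    rw [← this, A]
    refine tsum_congr fun k => ?_
    ring
  rw [hA, add_sub_cancel_right, ← Real.norm_eq_abs]
  refine (tsum_of_norm_bounded hbound hle).trans ?_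
  rw [mul_one]
  gcongr

theorem quasi_interpolation_uniform_convergence (q α : ℝ) (hq0 : 0 < q) (hq1 : q < 1)
    (hα : 0 < α) (f : ℝ → ℝ) (hbd : ∃ M : ℝ, ∀ x : ℝ, |f x| ≤ M)
    (hf : UniformContinuous f) :
    Filter.Tendsto (fun n : ℕ => ⨆ x : ℝ, |A q α n f x - f x|) Filter.atTop (nhds 0) := by
  obtain ⟨M, hM⟩ := hbd
  have hM0 : 0 ≤ M := (abs_nonneg _).trans (hM 0)
  obtain ⟨C, hC0, hC⟩ := exists_moment_bound hq0 hq1 hα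
  rw [Metric.tendsto_atTop']
  intro ε hε
  obtain ⟨δ, hδ, hfδ⟩ := Metric.uniformContinuous_iff.1 hf (ε / 2) (half_pos hε)
  have hmod (a b : ℝ) : |f a - f b| ≤ ε / 2 + 2 * M / δ * |a - b| := by
    rcases lt_or_ge |a - b| δ with hab | hab
    · have h1 : |f a - f b| < ε / 2 := hfδ hab
      have h2 : 0 ≤ 2 * M / δ * |a - b| := by positivity
      linarith
    · have h1 : 2 * M ≤ 2 * M / δ * |a - b| := by
        rw [div_mul_eq_mul_div, le_div_iff₀ hδ]
        gcongr
      linarith [abs_sub (f a) (f b), hM a, hM b]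
  obtain ⟨N, hN⟩ := exists_nat_gt (2 * M / δ * C / (ε / 2))
  refine ⟨N, fun n hn => ?_⟩
  have hn0 : 0 < n := by omega
  have hn' : (0 : ℝ) < n := by exact_mod_cast hn0
  have hsmall : 2 * M / δ / n * C < ε / 2 := by
    have hNn : (N : ℝ) < n := by exact_mod_cast hn
    have := hN.trans hNn
    rw [div_lt_iff₀ (half_pos hε)] at this
    rw [div_mul_eq_mul_div, div_lt_iff₀ hn']
    linarith
  have hsup : ⨆ x : ℝ, |A q α n f x - f x| ≤ ε / 2 + 2 * M / δ / n * C :=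
    Real.iSup_le (fun x => abs_A_sub_le hq0 hq1 hα (by positivity) hmod hC hn0 x)
      (by positivity)
  rw [Real.dist_0_eq_abs, abs_of_nonneg (Real.iSup_nonneg fun x => abs_nonneg _)]
  linarith
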